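/- arXiv:2312.15680 — 2 statements merged into one kernel-verified Lean document; each statement's English description precedes it below -/
import Mathlib

section
/- Let R be a commutative ring, n ≥ 1, κ = (κ₁,…,κ_n) positive integers with N = κ₁+⋯+κ_n, y₁,…,y_n ∈ R, and m ∈ ℕ. Then det G_{(m)}(y,κ) = h_m(y^[κ]) · det G_∅(y,κ), where (m) denotes the one-part partition (m). -/
open scoped BigOperators

/-- Complete homogeneous polynomial of degree `m` evaluated at the list `l`
(`h₀ = 1`, `h_m = 0` for `m < 0`). -/
def homEval {R : Type*} [CommRing R] (l : List R) (m : ℤ) : R :=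
  if 0 ≤ m then
    ∑ f ∈ Finset.Nat.antidiagonalTuple l.length m.toNat, ∏ i, l.get i ^ f i
  else 0

/-- Elementary symmetric polynomial of degree `k` evaluated at the list `l`. -/
def esymmEval {R : Type*} [CommRing R] (l : List R) (k : ℕ) : R :=
  (((l : Multiset R).powersetCard k).map Multiset.prod).sum

/-- Power sum of degree `s` evaluated at the list `l`. -/
def psumEval {R : Type*} [CommRing R] (l : List R) (s : ℕ) : R :=
  (l.map (· ^ s)).sum

/-- The list `y^[κ]`: `y q` repeated `κ q` times, in order. -/
def repList {R : Type*} {n : ℕ} (y : Fin n → R) (κ : Fin n → ℕ) : List R :=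
  (List.ofFn fun q => List.replicate (κ q) (y q)).flatten

/-- Zero-based version of `γ(κ, p) = (q, r)`: the `p`-th entry (0-based) of the list
    `(0,0),…,(0,κ₀−1),(1,0),…,(1,κ₁−1),…`. -/
def gammaPair (n : ℕ) (κ : Fin n → ℕ) (p : ℕ) : ℕ × ℕ :=
  ((List.ofFn fun q : Fin n => (List.range (κ q)).map fun r => ((q : ℕ), r)).flatten).getD p (0, 0)

/-- The generalized confluent Vandermonde matrix `G_λ(y, κ)` (zero-based indices):
`G[j,p] = binom(N+λ_j−j−1, r) · y_q^(N+λ_j−j−r−1)` if the exponent is `≥ 0`, else `0`,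
where `(q, r) = gammaPair n κ p`. -/
def vanG (R : Type*) [CommRing R] {n : ℕ} (N : ℕ) (κ : Fin n → ℕ) (y : Fin n → R)
    (lam : Fin N → ℕ) : Matrix (Fin N) (Fin N) R :=
  Matrix.of fun j p =>
    if h : (gammaPair n κ (p : ℕ)).1 < n ∧
        (j : ℕ) + (gammaPair n κ (p : ℕ)).2 + 1 ≤ N + lam j then
      (Nat.choose (N + lam j - ((j : ℕ) + 1)) (gammaPair n κ (p : ℕ)).2 : R) *
        y ⟨(gammaPair n κ (p : ℕ)).1, h.1⟩ ^
          (N + lam j - ((j : ℕ) + (gammaPair n κ (p : ℕ)).2 + 1))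
    else 0

/-- The Jacobi–Trudi matrix `J_λ(x) = [h_{λ_j − j + k}(x)]`. -/
def jacobiTrudi (R : Type*) [CommRing R] (N : ℕ) (lam : Fin N → ℕ) (x : List R) :
    Matrix (Fin N) (Fin N) R :=
  Matrix.of fun j k => homEval x ((lam j : ℤ) - (j : ℕ) + (k : ℕ))

/-- The matrix `M(y, κ)` with entries `(−1)^{N−k−r+1} e_{N−k−r+1}(y^[κ − r b_q])`
(in one-based form); entries with `N−k−r+1 < 0` are `0`. -/
def matM (R : Type*) [CommRing R] {n : ℕ} (N : ℕ) (κ : Fin n → ℕ) (y : Fin n → R) :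
    Matrix (Fin N) (Fin N) R :=
  Matrix.of fun k p =>
    if h : (gammaPair n κ (p : ℕ)).1 < n ∧
        (k : ℕ) + (gammaPair n κ (p : ℕ)).2 + 1 ≤ N then
      (-1 : R) ^ (N - ((k : ℕ) + (gammaPair n κ (p : ℕ)).2 + 1)) *
        esymmEval
          (repList y (Function.update κ ⟨(gammaPair n κ (p : ℕ)).1, h.1⟩
            (κ ⟨(gammaPair n κ (p : ℕ)).1, h.1⟩ - ((gammaPair n κ (p : ℕ)).2 + 1))))
          (N - ((k : ℕ) + (gammaPair n κ (p : ℕ)).2 + 1))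
    else 0

/-- The column vector `H^N_{s,λ}(l) = (h_{s + λ_j − j}(l))_{j=1}^N` (one-based `j`). -/
def Hcol {R : Type*} [CommRing R] {N : ℕ} (lam : Fin N → ℕ) (s : ℕ) (l : List R) :
    Fin N → R :=
  fun j => homEval l ((s : ℤ) + lam j - ((j : ℕ) + 1))

section Auxiliary

open Polynomial

theorem sum_antidiagonalTuple_succ {M : Type*} [AddCommMonoid M] (k n : ℕ)
    (g : (Fin (k + 1) → ℕ) → M) :
    ∑ f ∈ Finset.Nat.antidiagonalTuple (k + 1) n, g f =
      ∑ p ∈ Finset.HasAntidiagonal.antidiagonal n,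
        ∑ f ∈ Finset.Nat.antidiagonalTuple k p.2, g (Fin.cons p.1 f) := by
  rw [Finset.sum_sigma']
  refine Finset.sum_bij' (fun f _ => ⟨(f 0, ∑ i, Fin.tail f i), Fin.tail f⟩)
    (fun s _ => Fin.cons s.1.1 s.2) ?_ ?_ ?_ ?_ ?_
  · intro f hf
    simpa [Finset.Nat.mem_antidiagonalTuple, Fin.sum_univ_succ, Fin.tail] using hf
  · rintro ⟨⟨a, b⟩, f⟩ hf
    simp only [Finset.mem_sigma, Finset.HasAntidiagonal.mem_antidiagonal,
      Finset.Nat.mem_antidiagonalTuple] at hf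
    simp [Finset.Nat.mem_antidiagonalTuple, Fin.sum_univ_succ, hf.2, hf.1]
  · intro f _
    simp
  · rintro ⟨⟨a, b⟩, f⟩ hf
    simp only [Finset.mem_sigma, Finset.HasAntidiagonal.mem_antidiagonal,
      Finset.Nat.mem_antidiagonalTuple] at hf
    obtain ⟨_, rfl⟩ := hf
    simp
  · intro f _
    simp

variable {R : Type*} [CommRing R]

theorem homEval_natCast (l : List R) (m : ℕ) :
    homEval l m =
      ∑ f ∈ Finset.Nat.antidiagonalTuple l.length m, ∏ i, l.get i ^ f i := by
  simp [homEval]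

theorem homEval_zero (l : List R) : homEval l ((0 : ℕ) : ℤ) = 1 := by
  rw [homEval_natCast, Finset.Nat.antidiagonalTuple_zero_right]
  simp

theorem homEval_nil_succ (m : ℕ) : homEval ([] : List R) ((m + 1 : ℕ) : ℤ) = 0 := by
  rw [homEval_natCast]
  simp

theorem homEval_cons (x : R) (l : List R) (m : ℕ) :
    homEval (x :: l) (m : ℤ) =
      ∑ p ∈ Finset.HasAntidiagonal.antidiagonal m, x ^ p.1 * homEval l (p.2 : ℤ) := by
  rw [homEval_natCast]
  refine (sum_antidiagonalTuple_succ l.length m _).trans (Finset.sum_congr rfl fun p _ => ?_)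
  rw [homEval_natCast, Finset.mul_sum]
  refine Finset.sum_congr rfl fun f _ => ?_
  exact (Fin.prod_univ_succ _).trans (by simp)

theorem homEval_cons_succ (x : R) (l : List R) (m : ℕ) :
    homEval (x :: l) ((m + 1 : ℕ) : ℤ) =
      homEval l ((m + 1 : ℕ) : ℤ) + x * homEval (x :: l) (m : ℤ) := by
  rw [homEval_cons, homEval_cons, Finset.Nat.sum_antidiagonal_succ, Finset.mul_sum]
  simp [pow_succ', mul_assoc]

/-- Dividing `X ^ (N + m)` by `X * ∏ (X - x)`, the leading remainder coefficient is `h_m`. -/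
theorem exists_X_pow_eq_prod_mul_add (l : List R) (m : ℕ) :
    ∃ Q S : R[X], S.degree < l.length ∧
      (X : R[X]) ^ (l.length + m) =
        (l.map fun x => X - C x).prod * (X * Q) + C (homEval l (m : ℤ)) * X ^ l.length + S := by
  induction l generalizing m with
  | nil =>
    cases m with
    | zero => exact ⟨0, 0, by simp, by rw [homEval_zero]; simp⟩
    | succ m => exact ⟨X ^ m, 0, by simp, by rw [homEval_nil_succ]; simp [pow_succ']⟩
  | cons x l ih =>
    induction m with
    | zero => exact ⟨0, 0, by simp, by rw [homEval_zero]; simp⟩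
    | succ m ihm =>
      obtain ⟨Q₁, S₁, hS₁, h₁⟩ := ih (m + 1)
      obtain ⟨Q₂, S₂, hS₂, h₂⟩ := ihm
      refine ⟨Q₁ + C x * Q₂, X * S₁ + C x * S₂ -
        C x * (C (homEval l ((m + 1 : ℕ) : ℤ)) * X ^ l.length + S₁), ?_, ?_⟩
      · simp only [List.length_cons, ← mem_degreeLT] at hS₁ hS₂ ⊢
        have hmono : S₁ ∈ degreeLT R (l.length + 1) := degreeLT_mono (Nat.le_succ _) hS₁
        have hX : X * S₁ ∈ degreeLT R (l.length + 1) := by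
          rw [mem_degreeLT, degree_lt_iff_coeff_zero] at hS₁ ⊢
          intro k hk
          obtain ⟨k, rfl⟩ : ∃ j, k = j + 1 := ⟨k - 1, by omega⟩
          rw [coeff_X_mul]
          exact hS₁ k (by omega)
        have hpow : C (homEval l ((m + 1 : ℕ) : ℤ)) * X ^ l.length ∈
            degreeLT R (l.length + 1) := by
          rw [mem_degreeLT]
          exact (degree_C_mul_X_pow_le _ _).trans_lt (by exact_mod_cast Nat.lt_succ_self _)
        simp only [← smul_eq_C_mul] at hpow ⊢
        exact sub_mem (add_mem hX (Submodule.smul_mem _ _ hS₂))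
          (Submodule.smul_mem _ _ (add_mem hpow hmono))
      · rw [homEval_cons_succ]
        simp only [List.length_cons, List.map_cons, List.prod_cons, map_add, map_mul] at h₂ ⊢
        have h₃ : (X : R[X]) ^ (l.length + 1 + m) = X ^ (l.length + (m + 1)) := by
          congr 1; omega
        have h₄ : (X : R[X]) ^ (l.length + 1 + (m + 1)) = X * X ^ (l.length + (m + 1)) := by
          rw [← pow_succ']; congr 1; omega
        rw [h₄]
        rw [h₃] at h₂
        linear_combination (X - C x) * h₁ + C x * h₂

theorem exists_X_pow_eq_prod_mul_add_sum (l : List R) (M m : ℕ) (hl : l.length = M + 1) :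
    ∃ (Q : R[X]) (c : Fin (M + 1) → R), c 0 = homEval l (m : ℤ) ∧
      (X : R[X]) ^ (M + m) =
        (l.map fun x => X - C x).prod * Q + ∑ k : Fin (M + 1), C (c k) * X ^ (M - k : ℕ) := by
  obtain ⟨Q, S, hS, h⟩ := exists_X_pow_eq_prod_mul_add l m
  set P := (l.map fun x => X - C x).prod
  set F : R[X] := X ^ (M + m) - P * Q with hF
  have hXF : X * F = C (homEval l (m : ℤ)) * X ^ (M + 1) + S := by
    have : (X : R[X]) ^ (l.length + m) = X * X ^ (M + m) := by
      rw [← pow_succ', hl]; congr 1; omega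
    rw [this, hl] at h
    rw [hF]
    linear_combination h
  rw [hl, degree_lt_iff_coeff_zero] at hS
  have hcoeff (i : ℕ) (hi : M ≤ i) :
      F.coeff i = if i = M then homEval l (m : ℤ) else 0 := by
    rw [← coeff_X_mul F i, hXF, coeff_add, hS _ (by omega), coeff_C_mul_X_pow]
    simp
  refine ⟨Q, fun k => F.coeff (M - k : ℕ), by simp [hcoeff], ?_⟩
  have hsum : F = ∑ k : Fin (M + 1), C (F.coeff (M - k : ℕ)) * X ^ (M - k : ℕ) := by
    have hdeg : F.natDegree ≤ M := by
      rw [natDegree_le_iff_coeff_eq_zero]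
      intro i hi
      rw [hcoeff i hi.le, if_neg hi.ne']
    conv_lhs => rw [F.as_sum_range' (M + 1) (Nat.lt_succ_of_le hdeg)]
    rw [← Finset.sum_range_reflect, Finset.sum_range]
    exact Finset.sum_congr rfl fun k _ => by simp [C_mul_X_pow_eq_monomial]
  rw [← hsum, hF]
  ring

theorem coeff_taylor_X_pow (y : R) (k r : ℕ) :
    (taylor y (X ^ k)).coeff r = (k.choose r : R) * y ^ (k - r) := by
  rw [taylor_coeff, ← monomial_one_right_eq_X_pow, hasseDeriv_monomial]
  simp

theorem coeff_taylor_of_pow_dvd {y : R} {k r : ℕ} (hr : r < k) {P : R[X]}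
    (h : (X - C y) ^ k ∣ P) : (taylor y P).coeff r = 0 := by
  obtain ⟨Q, rfl⟩ := h
  rw [taylor_mul, taylor_pow]
  simp [coeff_X_pow_mul', hr.not_ge]

theorem length_repList {α : Type*} {n : ℕ} (y : Fin n → α) (κ : Fin n → ℕ) :
    (repList y κ).length = ∑ q, κ q := by
  simp [repList, List.length_flatten, List.map_ofFn, List.sum_ofFn]

theorem prod_map_repList {n : ℕ} (y : Fin n → R) (κ : Fin n → ℕ) :
    ((repList y κ).map fun x => X - C x).prod = ∏ q, (X - C (y q)) ^ κ q := by
  simp [repList, List.map_flatten, List.prod_flatten, List.map_ofFn, List.prod_ofFn]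

theorem gammaPair_spec {n : ℕ} (κ : Fin n → ℕ) {p : ℕ} (hp : p < ∑ q, κ q) :
    ∃ q : Fin n, (gammaPair n κ p).1 = q ∧ (gammaPair n κ p).2 < κ q := by
  have hlen : p < (List.ofFn fun q : Fin n =>
      (List.range (κ q)).map fun r => ((q : ℕ), r)).flatten.length := by
    simpa [List.length_flatten, List.map_ofFn, List.sum_ofFn] using hp
  have hmem := List.getElem_mem hlen
  rw [← List.getD_eq_getElem _ (0, 0) hlen] at hmem
  change gammaPair n κ p ∈ _ at hmem
  simp only [List.mem_flatten, List.mem_ofFn] at hmem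
  obtain ⟨_, ⟨q, rfl⟩, hq⟩ := hmem
  obtain ⟨r, hr, heq⟩ := List.mem_map.1 hq
  refine ⟨q, ?_, ?_⟩ <;> rw [← heq]
  exact List.mem_range.1 hr

theorem vanG_apply_eq_coeff_taylor {n N : ℕ} (κ : Fin n → ℕ) (y : Fin n → R)
    (lam : Fin N → ℕ) (j p : Fin N) {q : Fin n} (hq : (gammaPair n κ p).1 = q) :
    vanG R N κ y lam j p =
      (taylor (y q) (X ^ (N + lam j - (j + 1) : ℕ))).coeff (gammaPair n κ p).2 := by
  rw [coeff_taylor_X_pow]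
  simp only [vanG, Matrix.of_apply, hq, Fin.eta, Fin.is_lt, true_and]
  split_ifs with h
  · congr 2
    omega
  · rw [Nat.choose_eq_zero_of_lt (by omega)]
    simp

end Auxiliary

/-- `det G_{(m)}(y,κ) = h_m(y^[κ]) · det G_∅(y,κ)` for the one-part
partition `(m)`. -/
theorem hom_repeated_bialternant {R : Type*} [CommRing R]
    (n : ℕ) (hn : 1 ≤ n) (κ : Fin n → ℕ) (hκ : ∀ q, 0 < κ q)
    (N : ℕ) (hN : N = ∑ q, κ q) (y : Fin n → R) (m : ℕ) :
    (vanG R N κ y fun j => if (j : ℕ) = 0 then m else 0).det =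
      homEval (repList y κ) (m : ℤ) * (vanG R N κ y fun _ => 0).det := by
  obtain ⟨M, rfl⟩ : ∃ M, N = M + 1 := by
    have := Finset.single_le_sum (f := κ) (fun _ _ => Nat.zero_le _)
      (Finset.mem_univ (⟨0, hn⟩ : Fin n))
    have := hκ ⟨0, hn⟩
    exact ⟨N - 1, by omega⟩
  obtain ⟨Q, c, hc, hX⟩ := exists_X_pow_eq_prod_mul_add_sum (repList y κ) M m
    ((length_repList y κ).trans hN.symm)
  rw [← hc, ← smul_eq_mul, ← Matrix.det_updateRow_sum]
  congr 1
  ext j p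
  obtain ⟨q, hq, hr⟩ := gammaPair_spec κ (p.is_lt.trans_eq hN)
  rcases eq_or_ne j 0 with rfl | hj
  · rw [Matrix.updateRow_self, Finset.sum_apply, vanG_apply_eq_coeff_taylor κ y _ 0 p hq]
    have hexp : M + 1 + (if ((0 : Fin (M + 1)) : ℕ) = 0 then m else 0) -
        (((0 : Fin (M + 1)) : ℕ) + 1) = M + m := by
      simp
    have hdvd : (Polynomial.X - Polynomial.C (y q)) ^ κ q ∣
        ((repList y κ).map fun x => Polynomial.X - Polynomial.C x).prod * Q := by
      rw [prod_map_repList]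
      exact (Finset.dvd_prod_of_mem (fun q => (Polynomial.X - Polynomial.C (y q)) ^ κ q)
        (Finset.mem_univ q)).mul_right Q
    rw [hexp, hX, map_add, Polynomial.coeff_add, coeff_taylor_of_pow_dvd hr hdvd, zero_add,
      map_sum, Polynomial.finsetSum_coeff]
    refine Finset.sum_congr rfl fun k _ => ?_
    rw [Pi.smul_apply, vanG_apply_eq_coeff_taylor κ y _ k p hq, ← Polynomial.smul_eq_C_mul,
      map_smul, Polynomial.coeff_smul]
    rw [show M + 1 + 0 - (k + 1 : ℕ) = M - k by omega, smul_eq_mul]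
  · have hj' : (j : ℕ) ≠ 0 := fun h => hj (Fin.ext h)
    rw [Matrix.updateRow_ne hj, vanG_apply_eq_coeff_taylor κ y _ j p hq,
      vanG_apply_eq_coeff_taylor κ y _ j p hq, if_neg hj']
end

section
/- Let R be a commutative ring, n ≥ 1, κ = (κ₁,…,κ_n) positive integers with N = κ₁+⋯+κ_n, and y₁,…,y_n ∈ R. Then det G_∅(y,κ) = (−1)^{∑_{j=1}^n κ_j(κ_j−1)/2} · ∏_{1 ≤ j < k ≤ n} (y_j − y_k)^{κ_j κ_k}. -/
open scoped BigOperators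

open Polynomial Finset

theorem sign_revPerm_eq (N : ℕ) :
    Equiv.Perm.sign (Fin.revPerm : Equiv.Perm (Fin N)) = (-1) ^ N.choose 2 := by
  rw [Equiv.Perm.sign_eq_prod_prod_Ioi]
  have h : ∀ i : Fin N, ∀ j ∈ Ioi i,
      (if Fin.revPerm i < Fin.revPerm j then 1 else -1 : ℤˣ) = -1 := by
    intro i j hij
    rw [if_neg]
    simpa using (mem_Ioi.1 hij).le
  rw [prod_congr rfl fun i _ => prod_congr rfl (h i)]
  simp only [prod_const, Fin.card_Ioi, prod_pow_eq_pow_sum]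
  rw [Nat.choose_two_right, ← Finset.sum_range_id, ← Finset.sum_range_reflect, Finset.sum_range]

theorem add_choose_two_eq (a b : ℕ) :
    (a + b).choose 2 = a.choose 2 + b.choose 2 + a * b := by
  induction b with
  | zero => simp
  | succ b ih =>
    rw [← add_assoc, Nat.choose_succ_succ', Nat.choose_succ_succ' b, ih]
    simp only [Nat.choose_one_right]
    ring

theorem sum_choose_two_eq {n : ℕ} (κ : Fin n → ℕ) :
    (∑ q, κ q).choose 2 = ∑ j, (κ j).choose 2 + ∑ j, ∑ k ∈ Ioi j, κ j * κ k := by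
  induction n with
  | zero => simp
  | succ n ih =>
    simp only [Fin.sum_univ_succ, Fin.sum_Ioi_zero, Fin.sum_Ioi_succ]
    rw [add_choose_two_eq, ih, mul_sum]
    ring

theorem getD_flatten_ofFn {α : Type*} (d : α) {n : ℕ} (κ : Fin n → ℕ)
    (f : Fin n → ℕ → α) (q : Fin n) (r : ℕ) (hr : r < κ q) :
    ((List.ofFn fun q : Fin n => (List.range (κ q)).map (f q)).flatten).getD
      (∑ l : Fin q, κ (Fin.castLE q.2.le l) + r) d = f q r := by
  induction n with
  | zero => exact q.elim0
  | succ n ih =>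
    rw [List.ofFn_succ, List.flatten_cons]
    cases q using Fin.cases with
    | zero =>
      have h : ∑ l : Fin (0 : Fin (n + 1)), κ (Fin.castLE (0 : Fin (n + 1)).2.le l) = 0 :=
        Fin.sum_univ_zero _
      rw [h, zero_add, List.getD_append _ _ _ _ (by simpa using hr)]
      simp [List.getD_eq_getElem?_getD, hr]
    | succ q =>
      have h : ∑ l : Fin q.succ, κ (Fin.castLE q.succ.2.le l) =
          κ 0 + ∑ l : Fin q, κ (Fin.castLE q.2.le l).succ := Fin.sum_univ_succ _
      rw [h, List.getD_append_right _ _ _ _ (by simp; omega)]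
      convert ih (fun q => κ q.succ) (fun q => f q.succ) q hr using 2
      simp; omega

theorem gammaPair_finSigmaFinEquiv {n : ℕ} {κ : Fin n → ℕ} (s : (q : Fin n) × Fin (κ q)) :
    gammaPair n κ (finSigmaFinEquiv s) = ((s.1 : ℕ), (s.2 : ℕ)) := by
  rw [finSigmaFinEquiv_apply]
  exact getD_flatten_ofFn (0, 0) κ (fun q r => ((q : ℕ), r)) s.1 s.2 s.2.2

theorem coe_finSigmaFinEquiv {n : ℕ} {κ : Fin n → ℕ} (s : (q : Fin n) × Fin (κ q)) :
    (finSigmaFinEquiv s : ℕ) = ∑ l ∈ Iio s.1, κ l + s.2 := by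
  rw [finSigmaFinEquiv_apply]
  congr 1
  refine sum_nbij (fun l => Fin.castLE s.1.2.le l) ?_ ?_ ?_ ?_
  · exact fun l _ => mem_Iio.2 l.2
  · exact (Fin.castLE_injective _).injOn
  · exact fun l hl => ⟨⟨l, (mem_Iio.1 hl : l < s.1)⟩, by simp, rfl⟩
  · exact fun _ _ => rfl

theorem lex_of_finSigmaFinEquiv_lt {n : ℕ} {κ : Fin n → ℕ} {s t : (q : Fin n) × Fin (κ q)}
    (h : finSigmaFinEquiv s < finSigmaFinEquiv t) :
    s.1 < t.1 ∨ s.1 = t.1 ∧ (s.2 : ℕ) < t.2 := by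
  rw [Fin.lt_def, coe_finSigmaFinEquiv, coe_finSigmaFinEquiv] at h
  obtain hlt | heq | hgt := lt_trichotomy s.1 t.1
  · exact Or.inl hlt
  · have hsum : ∑ l ∈ Iio s.1, κ l = ∑ l ∈ Iio t.1, κ l := by rw [heq]
    exact Or.inr ⟨heq, by omega⟩
  · have hle : ∑ l ∈ Iio t.1, κ l + κ t.1 ≤ ∑ l ∈ Iio s.1, κ l := by
      rw [sum_Iio_add_eq_sum_Iic]
      exact sum_le_sum_of_subset fun l hl => mem_Iio.2 ((mem_Iic.1 hl).trans_lt hgt)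
    have := t.2.2
    omega

section Newton

variable {R : Type*} [CommRing R] {n : ℕ} {κ : Fin n → ℕ}

/-- The Newton basis polynomial `∏_{l < q} (X - y_l)^{κ_l} · (X - y_q)^r` attached to the
position `(q, r)` in the list of nodes `y_q` with multiplicities `κ_q`. -/
noncomputable def confluentNewton (y : Fin n → R) (s : (q : Fin n) × Fin (κ q)) : R[X] :=
  (∏ l ∈ Iio s.1, (X - C (y l)) ^ κ l) * (X - C (y s.1)) ^ (s.2 : ℕ)

theorem confluentNewton_monic (y : Fin n → R) (s : (q : Fin n) × Fin (κ q)) :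
    (confluentNewton y s).Monic :=
  (monic_prod_of_monic _ _ fun l _ => (monic_X_sub_C (y l)).pow _).mul ((monic_X_sub_C _).pow _)

theorem natDegree_confluentNewton [Nontrivial R] (y : Fin n → R)
    (s : (q : Fin n) × Fin (κ q)) :
    (confluentNewton y s).natDegree = finSigmaFinEquiv s := by
  rw [coe_finSigmaFinEquiv, confluentNewton,
    (monic_prod_of_monic _ _ fun l _ => (monic_X_sub_C (y l)).pow _).natDegree_mul
      ((monic_X_sub_C _).pow _),
    natDegree_prod_of_monic _ _ fun l _ => (monic_X_sub_C (y l)).pow _,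
    (monic_X_sub_C _).natDegree_pow]
  simp [(monic_X_sub_C _).natDegree_pow]

theorem taylor_X_sub_C_self_pow (a : R) (m : ℕ) : taylor a ((X - C a) ^ m) = X ^ m := by
  simp [taylor_pow]

theorem coeff_taylor_eq_zero_of_dvd {a : R} {m r : ℕ} (hr : r < m) {f : R[X]}
    (h : (X - C a) ^ m ∣ f) : (taylor a f).coeff r = 0 := by
  obtain ⟨g, rfl⟩ := h
  rw [taylor_mul, taylor_X_sub_C_self_pow, coeff_X_pow_mul', if_neg (by omega)]

theorem coeff_taylor_confluentNewton_of_lt (y : Fin n → R) {s t : (q : Fin n) × Fin (κ q)}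
    (h : finSigmaFinEquiv s < finSigmaFinEquiv t) :
    (taylor (y s.1) (confluentNewton y t)).coeff s.2 = 0 := by
  obtain hlt | ⟨heq, hlt⟩ := lex_of_finSigmaFinEquiv_lt h
  · exact coeff_taylor_eq_zero_of_dvd s.2.2
      ((dvd_prod_of_mem (fun l => (X - C (y l)) ^ κ l) (mem_Iio.2 hlt)).mul_right _)
  · refine coeff_taylor_eq_zero_of_dvd hlt ?_
    rw [heq]
    exact dvd_mul_left _ _

theorem coeff_taylor_confluentNewton_self (y : Fin n → R) (s : (q : Fin n) × Fin (κ q)) :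
    (taylor (y s.1) (confluentNewton y s)).coeff s.2 =
      ∏ l ∈ Iio s.1, (y s.1 - y l) ^ κ l := by
  rw [confluentNewton, taylor_mul, taylor_X_sub_C_self_pow, coeff_mul_X_pow', if_pos le_rfl,
    Nat.sub_self, taylor_coeff_zero, eval_prod]
  simp

/-- The matrix of Hermite interpolation functionals on the monomials `X ^ m`. -/
noncomputable def hermiteMatrix (κ : Fin n → ℕ) (y : Fin n → R) :
    Matrix (Fin (∑ q, κ q)) (Fin (∑ q, κ q)) R :=
  Matrix.of fun m p =>
    (taylor (y (finSigmaFinEquiv.symm p).1) (X ^ (m : ℕ))).coeff (finSigmaFinEquiv.symm p).2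

theorem det_hermiteMatrix (y : Fin n → R) :
    (hermiteMatrix κ y).det = ∏ q, ∏ l ∈ Iio q, (y q - y l) ^ (κ l * κ q) := by
  nontriviality R
  let P : Fin (∑ q, κ q) → R[X] := fun m => confluentNewton y (finSigmaFinEquiv.symm m)
  have hdeg : ∀ m, (P m).natDegree = m := fun m => by
    rw [natDegree_confluentNewton, Equiv.apply_symm_apply]
  let W : Matrix (Fin (∑ q, κ q)) (Fin (∑ q, κ q)) R := Matrix.of fun m p =>
    (taylor (y (finSigmaFinEquiv.symm p).1) (P m)).coeff (finSigmaFinEquiv.symm p).2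
  have hW : W = (Matrix.of fun i j : Fin (∑ q, κ q) => (P j).coeff i).transpose *
      hermiteMatrix κ y := by
    ext m p
    simp only [W, hermiteMatrix, Matrix.mul_apply, Matrix.of_apply, Matrix.transpose_apply]
    conv_lhs => rw [(P m).as_sum_range' (∑ q, κ q) (by rw [hdeg]; exact m.2)]
    rw [map_sum, finsetSum_coeff, Finset.sum_range]
    refine sum_congr rfl fun k _ => ?_
    rw [← C_mul_X_pow_eq_monomial, taylor_mul, taylor_C, coeff_C_mul]
  have hdet : W.det = (hermiteMatrix κ y).det := by
    rw [hW, Matrix.det_mul, Matrix.det_transpose, Matrix.det_matrixOfPolynomials P hdeg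
      fun m => confluentNewton_monic y _, one_mul]
  have htri : W.IsUpperTriangular := fun m p hpm =>
    coeff_taylor_confluentNewton_of_lt y (by simpa using hpm)
  rw [← hdet, Matrix.det_of_isUpperTriangular htri, ← finSigmaFinEquiv.prod_comp,
    Fintype.prod_sigma]
  refine prod_congr rfl fun q _ => ?_
  have hdiag : ∀ r : Fin (κ q), W (finSigmaFinEquiv ⟨q, r⟩) (finSigmaFinEquiv ⟨q, r⟩) =
      ∏ l ∈ Iio q, (y q - y l) ^ κ l := fun r => by
    simp only [W, P, Matrix.of_apply]
    rw [Equiv.symm_apply_apply]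
    exact coeff_taylor_confluentNewton_self y ⟨q, r⟩
  simp only [hdiag, prod_const, card_univ, Fintype.card_fin, ← prod_pow, ← pow_mul]

theorem vanG_zero_eq_submatrix (y : Fin n → R) :
    vanG R (∑ q, κ q) κ y (fun _ => 0) = (hermiteMatrix κ y).submatrix Fin.revPerm id := by
  ext j p
  obtain ⟨s, rfl⟩ := finSigmaFinEquiv.surjective p
  simp only [vanG, hermiteMatrix, Matrix.submatrix_apply, Matrix.of_apply, id]
  rw [Equiv.symm_apply_apply]
  have hfst : (gammaPair n κ (finSigmaFinEquiv s)).1 = s.1 := by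
    rw [gammaPair_finSigmaFinEquiv]
  have hsnd : (gammaPair n κ (finSigmaFinEquiv s)).2 = s.2 := by
    rw [gammaPair_finSigmaFinEquiv]
  simp only [hfst, hsnd, Fin.revPerm_apply, Fin.val_rev, taylor_X_pow, coeff_X_add_C_pow,
    add_zero]
  split_ifs with h
  · rw [mul_comm]
    congr 2
    omega
  · rw [Nat.choose_eq_zero_of_lt, Nat.cast_zero, mul_zero]
    have := s.1.2
    have := j.2
    omega

end Newton

/-- `det G_∅(y,κ) = (−1)^{∑ κ_j(κ_j−1)/2} ∏_{j<k} (y_j − y_k)^{κ_j κ_k}`. -/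
theorem confluent_vandermonde_det_another_form {R : Type*} [CommRing R]
    (n : ℕ) (hn : 1 ≤ n) (κ : Fin n → ℕ) (hκ : ∀ q, 0 < κ q)
    (N : ℕ) (hN : N = ∑ q, κ q) (y : Fin n → R) :
    (vanG R N κ y fun _ => 0).det =
      (-1 : R) ^ (∑ j, κ j * (κ j - 1) / 2) *
        ∏ j, ∏ k ∈ Finset.Ioi j, (y j - y k) ^ (κ j * κ k) := by
  subst hN
  have hprod : ∏ q, ∏ l ∈ Iio q, (y q - y l) ^ (κ l * κ q) =
      (-1 : R) ^ (∑ j, ∑ k ∈ Ioi j, κ j * κ k) *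
        ∏ j, ∏ k ∈ Ioi j, (y j - y k) ^ (κ j * κ k) := by
    rw [prod_comm' (t' := univ) (s' := Ioi) (by simp)]
    simp only [← prod_pow_eq_pow_sum, ← prod_mul_distrib, ← mul_pow, neg_one_mul, neg_sub]
  rw [vanG_zero_eq_submatrix, Matrix.det_permute, sign_revPerm_eq, det_hermiteMatrix, hprod,
    sum_choose_two_eq, ← mul_assoc]
  congr 1
  simp only [← Nat.choose_two_right]
  push_cast
  rw [pow_add, mul_assoc, ← mul_pow]
  simp
end
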